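/- Let n ≥ 3, m ≥ 2, and for each ε ∈ (0, 4/(n−2)) let u_ε be a radial Neumann solution with exactly m−1 interior zeros, with largest interior zero ρ_{1,ε}. Then ρ_{1,ε} → 0 as ε → 0⁺ and, for every a ∈ (0,1), sup over r ∈ [a,1] of | |u_ε(r)/u_ε(1)| − 1 | → 0 as ε → 0⁺ (i.e. |u_ε/u_ε(1)| → 1 uniformly on [a,1]). -/

import Mathlib

open Real Set Filter Topology MeasureTheory

noncomputable section

/-- `κ_n = ((n-2)/4) · Γ(n/2)² / Γ(n)`. -/
def kappa (n : ℕ) : ℝ :=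
  (((n : ℝ) - 2) / 4) * Real.Gamma ((n : ℝ) / 2) ^ 2 / Real.Gamma (n : ℝ)

/-- `p_ε = (n+2)/(n-2) - ε`. -/
def pEps (n : ℕ) (ε : ℝ) : ℝ := ((n : ℝ) + 2) / ((n : ℝ) - 2) - ε

/-- `u ∈ C²([0,1])` is a radial solution of `-Δu = |u|^{p-1} u` on the unit ball of `ℝⁿ`,
written in the radial variable: `(r^{n-1} u')' = -|u|^{p-1} u · r^{n-1}` on `(0,1]`,
with `u'(0) = 0`. -/
def IsRadialSolution (n : ℕ) (p : ℝ) (u : ℝ → ℝ) : Prop :=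
  ContDiffOn ℝ 2 u (Set.Icc 0 1) ∧ deriv u 0 = 0 ∧
    ∀ r ∈ Set.Ioc (0 : ℝ) 1,
      deriv (fun s => s ^ (n - 1) * deriv u s) r = -(|u r| ^ (p - 1) * u r * r ^ (n - 1))

/-- Radial Dirichlet solution with exactly `m-1` interior zeros, together with the
decreasing enumeration of its zeros `ρ 1 = 1 > ρ 2 > … > ρ m > 0` in `(0,1]` and of its
critical points `1 > δ 1 > … > δ m = 0` in `[0,1]`, interlaced as
`0 = δ m < ρ m < δ (m-1) < … < δ 1 < ρ 1 = 1`. -/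
def DirichletData (n : ℕ) (p : ℝ) (m : ℕ) (u : ℝ → ℝ) (ρ δ : ℕ → ℝ) : Prop :=
  IsRadialSolution n p u ∧ u 1 = 0 ∧ ρ 1 = 1 ∧ δ m = 0 ∧
    (∀ k, 1 ≤ k → k ≤ m → δ k < ρ k) ∧
    (∀ k, 1 ≤ k → k + 1 ≤ m → ρ (k + 1) < δ k) ∧
    {r : ℝ | r ∈ Set.Ioc (0 : ℝ) 1 ∧ u r = 0} = ρ '' Set.Icc 1 m ∧
    {r : ℝ | r ∈ Set.Icc (0 : ℝ) 1 ∧ deriv u r = 0} = δ '' Set.Icc 1 m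

/-- Radial Neumann solution with exactly `m-1` interior zeros, together with the
decreasing enumeration of its zeros `1 > ρ 1 > … > ρ (m-1) > 0` in `(0,1)` and of its
critical points `δ 1 = 1 > δ 2 > … > δ m = 0` in `[0,1]`, interlaced as
`0 = δ m < ρ (m-1) < δ (m-1) < … < ρ 1 < δ 1 = 1`. -/
def NeumannData (n : ℕ) (p : ℝ) (m : ℕ) (u : ℝ → ℝ) (ρ δ : ℕ → ℝ) : Prop :=
  IsRadialSolution n p u ∧ deriv u 1 = 0 ∧ δ 1 = 1 ∧ δ m = 0 ∧
    (∀ k, 1 ≤ k → k ≤ m - 1 → ρ k < δ k) ∧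
    (∀ k, 1 ≤ k → k ≤ m - 1 → δ (k + 1) < ρ k) ∧
    {r : ℝ | r ∈ Set.Ioo (0 : ℝ) 1 ∧ u r = 0} = ρ '' Set.Icc 1 (m - 1) ∧
    {r : ℝ | r ∈ Set.Icc (0 : ℝ) 1 ∧ deriv u r = 0} = δ '' Set.Icc 1 m

/-- A nontrivial radial Dirichlet solution with exactly `m-1` interior zeros. -/
def DirichletSol (n : ℕ) (p : ℝ) (m : ℕ) (u : ℝ → ℝ) : Prop :=
  IsRadialSolution n p u ∧ u 1 = 0 ∧ (∃ r ∈ Set.Icc (0 : ℝ) 1, u r ≠ 0) ∧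
    ∃ Z : Finset ℝ, (Z : Set ℝ) = {r | r ∈ Set.Ioo (0 : ℝ) 1 ∧ u r = 0} ∧ Z.card = m - 1

/-- A nontrivial radial Neumann solution with exactly `m-1` interior zeros. -/
def NeumannSol (n : ℕ) (p : ℝ) (m : ℕ) (u : ℝ → ℝ) : Prop :=
  IsRadialSolution n p u ∧ deriv u 1 = 0 ∧ (∃ r ∈ Set.Icc (0 : ℝ) 1, u r ≠ 0) ∧
    ∃ Z : Finset ℝ, (Z : Set ℝ) = {r | r ∈ Set.Ioo (0 : ℝ) 1 ∧ u r = 0} ∧ Z.card = m - 1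

/-- Hamiltonian -/
def Ham (p β : ℝ) (w z : ℝ → ℝ) (t : ℝ) : ℝ :=
  z t ^ 2 / 2 - β / 2 * w t ^ 2 + |w t| ^ (p + 1) / (p + 1)

lemma abs_rpow_split (p x : ℝ) (hp : 1 < p) : |x| ^ (p - 1) * x * x = |x| ^ (p + 1) := by
  rcases eq_or_ne x 0 with rfl | hx
  · simp [Real.zero_rpow (by linarith : p + 1 ≠ 0)]
  · have h0 : 0 < |x| := abs_pos.mpr hx
    have : p + 1 = (p - 1) + 2 := by ring
    rw [this, Real.rpow_add h0, mul_assoc]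
    congr 1
    rw [Real.rpow_two, sq_abs]; ring

lemma ham_deriv (p β c : ℝ) (hp : 1 < p) (w z : ℝ → ℝ) (t : ℝ)
    (hw : HasDerivAt w (z t) t)
    (hz : HasDerivAt z (c * z t + β * w t - |w t| ^ (p - 1) * w t) t) :
    HasDerivAt (Ham p β w z) (c * z t ^ 2) t := by
  have h1 := (hasDerivAt_abs_rpow (w t) (by linarith : 1 < p + 1)).comp t hw
  have h := (((hz.pow 2).div_const 2).sub ((hw.pow 2).const_mul (β / 2))).add (h1.div_const (p + 1))
  have hE : Ham p β w z = (((fun t => (z ^ 2) t / 2) - fun t => β / 2 * (w ^ 2) t) + fun x => ((fun x => |x| ^ (p + 1)) ∘ w) x / (p + 1)) := by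
    funext s; simp [Ham]
  rw [hE]
  refine h.congr_deriv ?_
  have : p + 1 - 2 = p - 1 := by ring
  rw [this]
  have : p + 1 ≠ 0 := by linarith
  field_simp
  push_cast
  ring

lemma exists_switch (Q : ℝ → ℝ) (x y : ℝ) (hxy : x ≤ y) (hQ : AntitoneOn Q (Ioo x y)) :
    ∃ s ∈ Icc x y, (∀ t ∈ Ioo x s, 0 ≤ Q t) ∧ (∀ t ∈ Ioo s y, Q t ≤ 0) := by
  set A : Set ℝ := insert x {t | t ∈ Ioo x y ∧ 0 ≤ Q t} with hA
  have hne : A.Nonempty := ⟨x, by simp [hA]⟩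
  have hbd : ∀ t ∈ A, t ≤ y := by
    intro t ht
    rcases ht with rfl | ht
    · exact hxy
    · exact ht.1.2.le
  have hB : BddAbove A := ⟨y, hbd⟩
  refine ⟨sSup A, ⟨le_csSup hB (by simp [hA]), csSup_le hne hbd⟩, ?_, ?_⟩
  · intro t ht
    obtain ⟨a, haA, hta⟩ := exists_lt_of_lt_csSup hne ht.2
    rcases haA with rfl | ha
    · exact absurd ht.1 (not_lt.mpr hta.le)
    · exact ha.2.trans (hQ ⟨ht.1, hta.trans ha.1.2⟩ ha.1 hta.le)
  · intro t ht
    by_contra hcon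
    push Not at hcon
    have hx : x ≤ sSup A := le_csSup hB (by simp [hA])
    have : t ∈ A := Or.inr ⟨⟨hx.trans_lt ht.1, ht.2⟩, hcon.le⟩
    exact absurd (le_csSup hB this) (not_le.mpr ht.1)

/-- one monotone piece -/
lemma piece (p β c C K : ℝ) (hp : 1 < p) (hc : 0 ≤ c) (w z : ℝ → ℝ)
    (hw : ∀ t < 0, HasDerivAt w (z t) t)
    (hz : ∀ t < 0, HasDerivAt z (c * z t + β * w t - |w t| ^ (p - 1) * w t) t)
    (x y : ℝ) (hxy : x ≤ y) (hy : y < 0)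
    (hC : ∀ t ∈ Icc x y, |w t| ≤ C) (hK : ∀ t ∈ Icc x y, |z t| ≤ K)
    (σ : ℝ) (hσ : σ = 1 ∨ σ = -1) (hs : ∀ t ∈ Ioo x y, 0 ≤ σ * z t) :
    Ham p β w z y - Ham p β w z x ≤ 2 * (c * K * C) := by
  have hK0 : 0 ≤ K := (abs_nonneg _).trans (hK x ⟨le_rfl, hxy⟩)
  have hd : ∀ t < 0, HasDerivAt (fun t => Ham p β w z t - c * K * σ * w t)
      (c * z t ^ 2 - c * K * σ * z t) t := fun t ht =>
    (ham_deriv p β c hp w z t (hw t ht) (hz t ht)).sub ((hw t ht).const_mul _)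
  have hanti : AntitoneOn (fun t => Ham p β w z t - c * K * σ * w t) (Icc x y) := by
    apply antitoneOn_of_deriv_nonpos (convex_Icc x y)
    · intro t ht
      exact (hd t (ht.2.trans_lt hy)).continuousAt.continuousWithinAt
    · intro t ht
      rw [interior_Icc] at ht
      exact (hd t (ht.2.trans hy)).differentiableAt.differentiableWithinAt
    · intro t ht
      rw [interior_Icc] at ht
      rw [(hd t (ht.2.trans hy)).deriv]
      have h1 := hs t ht
      have h2 := abs_le.mp (hK t ⟨ht.1.le, ht.2.le⟩)
      have h3 : z t ^ 2 ≤ K * (σ * z t) := by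
        rcases hσ with rfl | rfl <;> nlinarith
      have := mul_le_mul_of_nonneg_left h3 hc
      nlinarith
  have h := hanti ⟨le_rfl, hxy⟩ ⟨hxy, le_rfl⟩ hxy
  simp only at h
  have a1 := abs_le.mp (hC x ⟨le_rfl, hxy⟩)
  have a2 := abs_le.mp (hC y ⟨hxy, le_rfl⟩)
  have h4 : σ * w y - σ * w x ≤ 2 * C := by
    rcases hσ with rfl | rfl <;> linarith
  have := mul_le_mul_of_nonneg_left h4 (mul_nonneg hc hK0)
  nlinarith

lemma sign_const (w : ℝ → ℝ) (x y : ℝ) (hw : ContinuousOn w (Ioo x y))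
    (h0 : ∀ t ∈ Ioo x y, w t ≠ 0) :
    ∃ σ : ℝ, (σ = 1 ∨ σ = -1) ∧ ∀ t ∈ Ioo x y, 0 < σ * w t := by
  by_cases h : ∀ t ∈ Ioo x y, 0 < w t
  · exact ⟨1, Or.inl rfl, fun t ht => by simpa using h t ht⟩
  · push Not at h
    obtain ⟨a, ha, hwa⟩ := h
    refine ⟨-1, Or.inr rfl, fun t ht => ?_⟩
    by_contra hcon
    have hwt : 0 ≤ w t := by linarith
    obtain ⟨s, hs, hs0⟩ := isPreconnected_Ioo.intermediate_value ha ht hw ⟨hwa, hwt⟩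
    exact h0 s hs hs0

lemma nodal (p β c C K : ℝ) (hp : 1 < p) (hc : 0 ≤ c) (w z : ℝ → ℝ)
    (hw : ∀ t < 0, HasDerivAt w (z t) t)
    (hz : ∀ t < 0, HasDerivAt z (c * z t + β * w t - |w t| ^ (p - 1) * w t) t)
    (hH : ∀ t < 0, 0 ≤ Ham p β w z t)
    (x y : ℝ) (hxy : x ≤ y) (hy : y < 0)
    (hC : ∀ t ∈ Icc x y, |w t| ≤ C) (hK : ∀ t ∈ Icc x y, |z t| ≤ K)
    (h0 : ∀ t ∈ Ioo x y, w t ≠ 0) :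
    Ham p β w z y - Ham p β w z x ≤ 4 * (c * K * C) := by
  obtain ⟨σ, hσ, hsw⟩ := sign_const w x y
    (fun t ht => (hw t (ht.2.trans hy)).continuousAt.continuousWithinAt) h0
  have hd : ∀ t ∈ Ioo x y, HasDerivAt (fun t => Real.exp (-c * t) * (z t / w t))
      (Real.exp (-c * t) * (-c * 1) * (z t / w t) + Real.exp (-c * t) *
        (((c * z t + β * w t - |w t| ^ (p - 1) * w t) * w t - z t * z t) / w t ^ 2)) t := by
    intro t ht
    have ht0 := ht.2.trans hy
    exact (((hasDerivAt_id t).const_mul (-c)).exp).mul ((hz t ht0).div (hw t ht0) (h0 t ht))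
  have hQ : AntitoneOn (fun t => Real.exp (-c * t) * (z t / w t)) (Ioo x y) := by
    apply antitoneOn_of_deriv_nonpos (convex_Ioo x y)
    · intro t ht
      exact (hd t ht).continuousAt.continuousWithinAt
    · intro t ht
      rw [interior_Ioo] at ht
      exact (hd t ht).differentiableAt.differentiableWithinAt
    · intro t ht
      rw [interior_Ioo] at ht
      rw [(hd t ht).deriv]
      have ht0 := ht.2.trans hy
      have hwt := h0 t ht
      have e1 : Real.exp (-c * t) * (-c * 1) * (z t / w t) + Real.exp (-c * t) *
        (((c * z t + β * w t - |w t| ^ (p - 1) * w t) * w t - z t * z t) / w t ^ 2)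
        = Real.exp (-c * t) / w t ^ 2 *
          (β * w t ^ 2 - |w t| ^ (p - 1) * w t * w t - z t ^ 2) := by
        field_simp
        ring
      rw [e1, abs_rpow_split p _ hp]
      have hH' := hH t ht0
      unfold Ham at hH'
      have hX : 0 ≤ |w t| ^ (p + 1) := Real.rpow_nonneg (abs_nonneg _) _
      have hX2 : |w t| ^ (p + 1) / (p + 1) ≤ |w t| ^ (p + 1) / 2 :=
        div_le_div_of_nonneg_left hX (by norm_num) (by linarith)
      apply mul_nonpos_of_nonneg_of_nonpos (by positivity)
      linarith
  obtain ⟨s, hs, hs1, hs2⟩ := exists_switch _ x y hxy hQ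
  have hzsign : ∀ t ∈ Ioo x y, ∀ q, q = z t / w t → σ * z t = q * (σ * w t) := by
    intro t ht q hq
    have := h0 t ht
    rw [hq]; field_simp
  have A1 := piece p β c C K hp hc w z hw hz x s hs.1 (hs.2.trans_lt hy)
    (fun t ht => hC t ⟨ht.1, ht.2.trans hs.2⟩) (fun t ht => hK t ⟨ht.1, ht.2.trans hs.2⟩) σ hσ
    (by
      intro t ht
      have htI : t ∈ Ioo x y := ⟨ht.1, ht.2.trans_le hs.2⟩
      rw [hzsign t htI _ rfl]
      have := nonneg_of_mul_nonneg_right (hs1 t ht) (Real.exp_pos _)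
      exact mul_nonneg this (hsw t htI).le)
  have A2 := piece p β c C K hp hc w z hw hz s y hs.2 hy
    (fun t ht => hC t ⟨hs.1.trans ht.1, ht.2⟩) (fun t ht => hK t ⟨hs.1.trans ht.1, ht.2⟩) (-σ)
    (by rcases hσ with rfl | rfl <;> simp)
    (by
      intro t ht
      have htI : t ∈ Ioo x y := ⟨hs.1.trans_lt ht.1, ht.2⟩
      have h1 := hs2 t ht
      have h2 : z t / w t ≤ 0 := by
        by_contra hcon
        push Not at hcon
        exact absurd (mul_pos (Real.exp_pos (-c * t)) hcon) (not_lt.mpr h1)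
      have := mul_nonpos_of_nonpos_of_nonneg h2 (hsw t htI).le
      rw [← hzsign t htI _ rfl] at this
      linarith)
  linarith

lemma multi_nodal (p β c C K : ℝ) (hp : 1 < p) (hc : 0 ≤ c) (w z : ℝ → ℝ)
    (hw : ∀ t < 0, HasDerivAt w (z t) t)
    (hz : ∀ t < 0, HasDerivAt z (c * z t + β * w t - |w t| ^ (p - 1) * w t) t)
    (hH : ∀ t < 0, 0 ≤ Ham p β w z t)
    (x : ℝ) (N : ℕ) : ∀ (y : ℝ) (_ : x ≤ y) (_ : y < 0)
    (_ : ∀ t ∈ Icc x y, |w t| ≤ C) (_ : ∀ t ∈ Icc x y, |z t| ≤ K)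
    (S : Finset ℝ) (_ : S.card ≤ N) (_ : ∀ t ∈ Ioo x y, w t = 0 → t ∈ S),
    Ham p β w z y - Ham p β w z x ≤ 4 * (c * K * C) * (N + 1) := by
  induction N with
  | zero =>
    intro y hxy hy hC hK S hS h0
    have : S = ∅ := Finset.card_eq_zero.mp (by omega)
    subst this
    have := nodal p β c C K hp hc w z hw hz hH x y hxy hy hC hK (fun t ht h => by
      simpa using h0 t ht h)
    simpa using this
  | succ N ih =>
    intro y hxy hy hC hK S hS h0
    have hK0 : 0 ≤ K := (abs_nonneg _).trans (hK x ⟨le_rfl, hxy⟩)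
    have hC0 : 0 ≤ C := (abs_nonneg _).trans (hC x ⟨le_rfl, hxy⟩)
    have hpos : 0 ≤ 4 * (c * K * C) := by positivity
    set T := S.filter (fun t => t ∈ Ioo x y ∧ w t = 0) with hT
    by_cases hne : T.Nonempty
    · set a := T.max' hne with ha
      have haT : a ∈ T := T.max'_mem hne
      have haI := (Finset.mem_filter.mp haT).2.1
      have haS := (Finset.mem_filter.mp haT).1
      have B1 := ih a haI.1.le (haI.2.trans hy) (fun t ht => hC t ⟨ht.1, ht.2.trans haI.2.le⟩)
        (fun t ht => hK t ⟨ht.1, ht.2.trans haI.2.le⟩) (S.erase a)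
        (by rw [Finset.card_erase_of_mem haS]; omega)
        (fun t ht h => Finset.mem_erase.mpr ⟨ht.2.ne, h0 t ⟨ht.1, ht.2.trans haI.2⟩ h⟩)
      have B2 := nodal p β c C K hp hc w z hw hz hH a y haI.2.le hy
        (fun t ht => hC t ⟨haI.1.le.trans ht.1, ht.2⟩)
        (fun t ht => hK t ⟨haI.1.le.trans ht.1, ht.2⟩)
        (fun t ht h => by
          have hI : t ∈ Ioo x y := ⟨haI.1.trans ht.1, ht.2⟩
          have : t ∈ T := Finset.mem_filter.mpr ⟨h0 t hI h, hI, h⟩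
          exact absurd (T.le_max' t this) (not_le.mpr ht.1))
      push_cast
      linarith
    · have B2 := nodal p β c C K hp hc w z hw hz hH x y hxy hy hC hK
        (fun t ht h => hne ⟨t, Finset.mem_filter.mpr ⟨h0 t ht h, ht, h⟩⟩)
      push_cast
      have : (0 : ℝ) ≤ N := Nat.cast_nonneg N
      nlinarith

lemma ham_bound (p β c C K : ℝ) (hp : 1 < p) (hc : 0 ≤ c) (w z : ℝ → ℝ)
    (hw : ∀ t < 0, HasDerivAt w (z t) t)
    (hz : ∀ t < 0, HasDerivAt z (c * z t + β * w t - |w t| ^ (p - 1) * w t) t)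
    (lw : Tendsto w atBot (𝓝 0)) (lz : Tendsto z atBot (𝓝 0))
    (hb : ∀ t < 0, Ham p β w z t ≤ 1 → |w t| ≤ C ∧ |z t| ≤ K)
    (N : ℕ) (S : Finset ℝ) (hS : S.card ≤ N) (h0 : ∀ t < 0, w t = 0 → t ∈ S)
    (hsmall : 4 * (c * K * C) * (N + 1) < 1) :
    ∀ t < 0, Ham p β w z t ≤ 4 * (c * K * C) * (N + 1) := by
  have hd : ∀ t < 0, HasDerivAt (Ham p β w z) (c * z t ^ 2) t := fun t ht =>
    ham_deriv p β c hp w z t (hw t ht) (hz t ht)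
  have hmono : MonotoneOn (Ham p β w z) (Iio 0) := by
    apply monotoneOn_of_deriv_nonneg (convex_Iio 0)
    · intro t ht
      exact (hd t ht).continuousAt.continuousWithinAt
    · intro t ht
      rw [interior_Iio] at ht
      exact (hd t ht).differentiableAt.differentiableWithinAt
    · intro t ht
      rw [interior_Iio] at ht
      rw [(hd t ht).deriv]
      positivity
  have hlim : Tendsto (Ham p β w z) atBot (𝓝 0) := by
    have h1 : Tendsto (fun t => |w t| ^ (p + 1)) atBot (𝓝 (|(0 : ℝ)| ^ (p + 1))) :=
      lw.abs.rpow_const (Or.inr (by linarith))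
    have h := (((lz.pow 2).div_const 2).sub ((lw.pow 2).const_mul (β / 2))).add
      (h1.div_const (p + 1))
    have e : (0 : ℝ) ^ 2 / 2 - β / 2 * 0 ^ 2 + |(0 : ℝ)| ^ (p + 1) / (p + 1) = 0 := by
      simp [Real.zero_rpow (by linarith : p + 1 ≠ 0)]
    rw [e] at h
    exact h
  have hH : ∀ t < 0, 0 ≤ Ham p β w z t := by
    intro t ht
    apply le_of_tendsto hlim
    filter_upwards [eventually_le_atBot t] with s hs
    exact hmono (lt_of_le_of_lt hs ht) ht hs
  intro t0 ht0
  by_contra hcon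
  push Not at hcon
  obtain ⟨t1, ht1, hl, hle⟩ : ∃ t1 < 0, 4 * (c * K * C) * (N + 1) < Ham p β w z t1 ∧
      Ham p β w z t1 ≤ 1 := by
    by_cases h : Ham p β w z t0 ≤ 1
    · exact ⟨t0, ht0, hcon, h⟩
    · push Not at h
      obtain ⟨a, hat, ha⟩ := ((eventually_le_atBot t0).and
        (hlim.eventually (gt_mem_nhds one_pos))).exists
      have hcont : ContinuousOn (Ham p β w z) (Icc a t0) := fun s hs =>
        (hd s (hs.2.trans_lt ht0)).continuousAt.continuousWithinAt
      obtain ⟨s, hs, hs1⟩ := intermediate_value_Icc hat hcont ⟨ha.le, h.le⟩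
      exact ⟨s, hs.2.trans_lt ht0, by rw [hs1]; exact hsmall, hs1.le⟩
  have hall : ∀ t ≤ t1, |w t| ≤ C ∧ |z t| ≤ K := fun t ht =>
    hb t (ht.trans_lt ht1) ((hmono (lt_of_le_of_lt ht ht1) ht1 ht).trans hle)
  have : Ham p β w z t1 ≤ 4 * (c * K * C) * (N + 1) := by
    have hl2 : Tendsto (fun x => Ham p β w z t1 - Ham p β w z x) atBot
        (𝓝 (Ham p β w z t1 - 0)) := hlim.const_sub _
    rw [sub_zero] at hl2
    apply le_of_tendsto hl2
    filter_upwards [eventually_le_atBot t1] with x hx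
    exact multi_nodal p β c C K hp hc w z hw hz hH x N t1 hx ht1
      (fun t ht => (hall t ht.2).1) (fun t ht => (hall t ht.2).2) S hS
      (fun t ht h => h0 t (ht.2.trans ht1) h)
  linarith

/-- consequences of `NeumannData` -/
lemma neumann_facts (n m : ℕ) (hn : 3 ≤ n) (hm : 2 ≤ m) (p : ℝ) (hp : 1 < p) (u : ℝ → ℝ)
    (ρ δ : ℕ → ℝ) (h : NeumannData n p m u ρ δ) :
    ContinuousOn u (Icc 0 1) ∧
    (∀ r ∈ Ioo (0 : ℝ) 1, HasDerivAt u (deriv u r) r) ∧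
    (∀ r ∈ Ioo (0 : ℝ) 1, HasDerivAt (deriv u)
      (-((n : ℝ) - 1) / r * deriv u r - |u r| ^ (p - 1) * u r) r) ∧
    (∀ r ∈ Ioo (0 : ℝ) 1, HasDerivAt (fun s => s ^ (n - 1) * deriv u s)
      (-(|u r| ^ (p - 1) * u r * r ^ (n - 1))) r) ∧
    (∃ B, ∀ r ∈ Ioo (0 : ℝ) 1, |u r| ≤ B ∧ |deriv u r| ≤ B) ∧
    u 1 ≠ 0 ∧ ContinuousAt (fun s => s ^ (n - 1) * deriv u s) 1 ∧ deriv u 1 = 0 ∧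
    ρ 1 ∈ Ioo (0 : ℝ) 1 ∧ u (ρ 1) = 0 ∧ (∀ r ∈ Ioo (ρ 1) 1, deriv u r ≠ 0) ∧
    (∀ r ∈ Ioo (0 : ℝ) 1, u r = 0 → r ∈ (Finset.Icc 1 (m - 1)).image ρ) := by
  obtain ⟨⟨hC2, -, hode⟩, hd1, hδ1, hδm, hρδ, hδρ, hZ, hK⟩ := h
  have hcont := hC2.continuousOn
  have hat : ∀ r ∈ Ioo (0 : ℝ) 1, ContDiffAt ℝ 2 u r := fun r hr =>
    hC2.contDiffAt (Icc_mem_nhds hr.1 hr.2)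
  have hu1 : ∀ r ∈ Ioo (0 : ℝ) 1, HasDerivAt u (deriv u r) r := fun r hr =>
    ((hat r hr).differentiableAt (by norm_num)).hasDerivAt
  have hu2 : ∀ r ∈ Ioo (0 : ℝ) 1, DifferentiableAt ℝ (deriv u) r := fun r hr => by
    have h1 : ContDiffAt ℝ 1 (deriv u) r := (hat r hr).derivWithin (by norm_num)
    exact h1.differentiableAt (by norm_num)
  have hφ : ∀ r ∈ Ioo (0 : ℝ) 1, HasDerivAt (fun s => s ^ (n - 1) * deriv u s)
      (-(|u r| ^ (p - 1) * u r * r ^ (n - 1))) r := fun r hr => by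
    rw [← hode r ⟨hr.1, hr.2.le⟩]
    apply DifferentiableAt.hasDerivAt
    exact (differentiableAt_pow _).mul (hu2 r hr)
  have hρ1 : ρ 1 ∈ Ioo (0 : ℝ) 1 ∧ u (ρ 1) = 0 := by
    have : ρ 1 ∈ ρ '' Icc 1 (m - 1) := ⟨1, ⟨le_rfl, by omega⟩, rfl⟩
    rw [← hZ] at this
    exact this
  have hanti : ∀ k, 1 ≤ k → k ≤ m - 1 → ρ k ≤ ρ 1 := by
    intro k hk
    induction k, hk using Nat.le_induction with
    | base => intro _; exact le_rfl
    | succ k hk ih =>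
      intro hk2
      have h1 := hρδ (k + 1) (by omega) hk2
      have h2 := hδρ k hk (by omega)
      have h3 := ih (by omega)
      linarith
  have hcrit : ∀ r ∈ Ioo (ρ 1) 1, deriv u r ≠ 0 := by
    intro r hr h0
    have : r ∈ {r : ℝ | r ∈ Set.Icc (0 : ℝ) 1 ∧ deriv u r = 0} :=
      ⟨⟨(hρ1.1.1.trans hr.1).le, hr.2.le⟩, h0⟩
    rw [hK] at this
    obtain ⟨j, hj, rfl⟩ := this
    rcases Nat.eq_or_lt_of_le hj.1 with h1 | h1
    · rw [← h1, hδ1] at hr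
      exact lt_irrefl _ hr.2
    · have h2 := hδρ (j - 1) (by omega) (by have := hj.2; omega)
      rw [Nat.sub_add_cancel hj.1] at h2
      have h3 := hanti (j - 1) (by omega) (by have := hj.2; omega)
      linarith [hr.1]
  have hne : u 1 ≠ 0 := by
    intro h0
    obtain ⟨s, hs, hs0⟩ := exists_deriv_eq_zero hρ1.1.2
      (hcont.mono (Icc_subset_Icc_left hρ1.1.1.le)) (by rw [hρ1.2, h0])
    exact hcrit s hs hs0
  have hc1 : ContinuousAt (fun s => s ^ (n - 1) * deriv u s) 1 := by
    apply DifferentiableAt.continuousAt (𝕜 := ℝ)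
    apply differentiableAt_of_deriv_ne_zero
    rw [hode 1 ⟨one_pos, le_rfl⟩]
    simp only [one_pow, mul_one, ne_eq, neg_eq_zero, mul_eq_zero, not_or]
    exact ⟨(Real.rpow_pos_of_pos (abs_pos.mpr hne) _).ne', hne⟩
  refine ⟨hcont, hu1, ?_, hφ, ?_, hne, hc1, hd1, hρ1.1, hρ1.2, hcrit, ?_⟩
  · intro r hr
    have h1 : HasDerivAt (fun s : ℝ => s ^ (n - 1)) _ r := hasDerivAt_pow (n - 1) r
    have h2 := (h1.mul (hu2 r hr).hasDerivAt).unique (hφ r hr)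
    refine (hu2 r hr).hasDerivAt.congr_deriv ?_
    obtain ⟨k, rfl⟩ : ∃ k, n = k + 2 := ⟨n - 2, by omega⟩
    have e : k + 2 - 1 = k + 1 := by omega
    have e' : k + 1 - 1 = k := by omega
    rw [e, e'] at h2
    have hr0 := hr.1.ne'
    have hrk : r ^ k ≠ 0 := pow_ne_zero _ hr0
    have h3 : r ^ k * (((k : ℝ) + 1) * deriv u r + r * deriv (deriv u) r) =
        r ^ k * (-(|u r| ^ (p - 1) * u r * r)) := by
      push_cast at h2
      rw [pow_succ] at h2
      linarith
    have h4 := mul_left_cancel₀ hrk h3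
    push_cast
    field_simp
    linarith
  · have hdw : ContinuousOn (derivWithin u (Icc 0 1)) (Icc 0 1) :=
      hC2.continuousOn_derivWithin (uniqueDiffOn_Icc one_pos) (by norm_num)
    obtain ⟨B1, hB1⟩ := isCompact_Icc.exists_bound_of_continuousOn hcont
    obtain ⟨B2, hB2⟩ := isCompact_Icc.exists_bound_of_continuousOn hdw
    refine ⟨max B1 B2, fun r hr => ⟨(hB1 r ⟨hr.1.le, hr.2.le⟩).trans (le_max_left _ _), ?_⟩⟩
    have := hB2 r ⟨hr.1.le, hr.2.le⟩
    rw [derivWithin_of_mem_nhds (Icc_mem_nhds hr.1 hr.2)] at this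
    exact this.trans (le_max_right _ _)
  · intro r hr h0
    have : r ∈ {r : ℝ | r ∈ Set.Ioo (0 : ℝ) 1 ∧ u r = 0} := ⟨hr, h0⟩
    rw [hZ] at this
    obtain ⟨j, hj, rfl⟩ := this
    exact Finset.mem_image.mpr ⟨j, Finset.mem_Icc.mpr hj, rfl⟩

/-- elementary: bound on `w` and `z` from the Hamiltonian -/
lemma ham_le_one_bound (q0 P β0 : ℝ) (hq0 : 0 < q0) (hP : 2 ≤ P) (hβ0 : 0 ≤ β0) :
    ∃ C K : ℝ, 0 ≤ C ∧ 0 ≤ K ∧ ∀ (p β : ℝ) (w z : ℝ → ℝ) (t : ℝ), q0 ≤ p - 1 → p + 1 ≤ P → β ≤ β0 →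
      Ham p β w z t ≤ 1 → |w t| ≤ C ∧ |z t| ≤ K := by
  set B := P * (1 + β0 / 2) with hB
  have hB1 : 1 ≤ B := by nlinarith
  set C := B ^ (1 / q0) with hC
  have hC1 : 1 ≤ C := Real.one_le_rpow hB1 (by positivity)
  refine ⟨C, 2 + β0 * C ^ 2, by linarith, by positivity, ?_⟩
  intro p β w z t hp hpP hβ hH
  unfold Ham at hH
  have hw2 : β / 2 * w t ^ 2 ≤ β0 / 2 * |w t| ^ 2 := by
    rw [sq_abs]
    exact mul_le_mul_of_nonneg_right (by linarith) (sq_nonneg _)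
  have hpp : 0 < p + 1 := by linarith
  have hX : 0 ≤ |w t| ^ (p + 1) / (p + 1) := by positivity
  have hwC : |w t| ≤ C := by
    by_contra hcon
    push Not at hcon
    set s := |w t| with hs
    have hs1 : 1 < s := hC1.trans_lt hcon
    have h1 : s ^ (p + 1) / (p + 1) ≤ (1 + β0 / 2) * s ^ 2 := by nlinarith [sq_nonneg (z t)]
    rw [div_le_iff₀ hpp] at h1
    have e : p + 1 = (p - 1) + 2 := by ring
    have h2 : s ^ (p + 1) = s ^ (p - 1) * s ^ 2 := by
      rw [e, Real.rpow_add (by linarith), Real.rpow_two]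
    have h3 : s ^ (p - 1) * s ^ 2 ≤ B * s ^ 2 := by
      rw [← h2]
      refine h1.trans ?_
      have : 0 ≤ (1 + β0 / 2) * s ^ 2 := by positivity
      calc (1 + β0 / 2) * s ^ 2 * (p + 1) ≤ (1 + β0 / 2) * s ^ 2 * P :=
            mul_le_mul_of_nonneg_left hpP this
        _ = B * s ^ 2 := by rw [hB]; ring
    have h4 : s ^ (p - 1) ≤ B := le_of_mul_le_mul_right h3 (by positivity)
    have h5 : s ^ q0 ≤ B := (Real.rpow_le_rpow_of_exponent_le hs1.le hp).trans h4
    have h6 : C ^ q0 < s ^ q0 := Real.rpow_lt_rpow (by linarith) hcon hq0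
    have h7 : C ^ q0 = B := by
      rw [hC, ← Real.rpow_mul (by linarith)]
      rw [one_div, inv_mul_cancel₀ hq0.ne', Real.rpow_one]
    linarith
  refine ⟨hwC, ?_⟩
  have h1 : |w t| ^ 2 ≤ C ^ 2 := pow_le_pow_left₀ (abs_nonneg _) hwC 2
  have h2 : z t ^ 2 ≤ 2 + β0 * C ^ 2 := by nlinarith
  apply abs_le_of_sq_le_sq _ (by positivity)
  have : 0 ≤ β0 * C ^ 2 := by positivity
  nlinarith

/-- key estimate -/
lemma key_estimate (n m : ℕ) (hn : 3 ≤ n) (hm : 2 ≤ m) (p : ℝ) (hp : 1 < p) (u : ℝ → ℝ)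
    (ρ δ : ℕ → ℝ) (h : NeumannData n p m u ρ δ) (c β C K : ℝ)
    (hc : c = 4 / (p - 1) - ((n : ℝ) - 2)) (hc0 : 0 ≤ c)
    (hβ : β = 2 / (p - 1) * ((n : ℝ) - 2 - 2 / (p - 1)))
    (hb : ∀ (w z : ℝ → ℝ) (t : ℝ), Ham p β w z t ≤ 1 → |w t| ≤ C ∧ |z t| ≤ K)
    (hsmall : 4 * (c * K * C) * m < 1) :
    |u 1| ^ (p + 1) ≤ (p + 1) * (4 * (c * K * C) * m) := by
  obtain ⟨hcont, hu1, hu2, hφ, ⟨B, hB⟩, hne, hc1, hd1, hρ, hρ0, hcrit, hzero⟩ :=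
    neumann_facts n m hn hm p hp u ρ δ h
  have hp1 : 0 < p - 1 := by linarith
  set α := 2 / (p - 1) with hα
  have hα0 : 0 < α := by positivity
  have hcα : c = 2 * α - ((n : ℝ) - 2) := by rw [hc, hα]; ring
  have hαp : α * (p - 1) = 2 := by rw [hα]; field_simp
  set w : ℝ → ℝ := fun t => Real.exp (α * t) * u (Real.exp t) with hw
  set z : ℝ → ℝ := fun t => Real.exp (α * t) *
    (α * u (Real.exp t) + Real.exp t * deriv u (Real.exp t)) with hz
  have hI : ∀ t < 0, Real.exp t ∈ Ioo (0 : ℝ) 1 := fun t ht =>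
    ⟨Real.exp_pos t, Real.exp_lt_one_iff.mpr ht⟩
  have hEα : ∀ t, HasDerivAt (fun t => Real.exp (α * t)) (Real.exp (α * t) * (α * 1)) t :=
    fun t => ((hasDerivAt_id t).const_mul α).exp
  have hw' : ∀ t < 0, HasDerivAt w (z t) t := by
    intro t ht
    have h1 := (hu1 _ (hI t ht)).comp t (Real.hasDerivAt_exp t)
    refine ((hEα t).mul h1).congr_deriv ?_
    simp only [hz, Function.comp]
    ring
  have hz' : ∀ t < 0, HasDerivAt z (c * z t + β * w t - |w t| ^ (p - 1) * w t) t := by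
    intro t ht
    have h1 := (hu1 _ (hI t ht)).comp t (Real.hasDerivAt_exp t)
    have h2 := (hu2 _ (hI t ht)).comp t (Real.hasDerivAt_exp t)
    refine ((hEα t).mul ((h1.const_mul α).add ((Real.hasDerivAt_exp t).mul h2))).congr_deriv ?_
    have e1 : |w t| ^ (p - 1) = Real.exp t ^ 2 * |u (Real.exp t)| ^ (p - 1) := by
      simp only [hw]
      rw [abs_mul, abs_of_pos (Real.exp_pos _), Real.mul_rpow (Real.exp_pos _).le (abs_nonneg _),
        ← Real.exp_mul, ← Real.exp_nat_mul]
      congr 2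
      push_cast
      linear_combination t * hαp
    rw [e1]
    simp only [hz, hw, Function.comp, hcα, hβ, Pi.add_apply, Pi.mul_apply]
    have := (Real.exp_pos t).ne'
    field_simp
    ring
  have hexpα : Tendsto (fun t => Real.exp (α * t)) atBot (𝓝 0) :=
    Real.tendsto_exp_atBot.comp (tendsto_id.const_mul_atBot hα0)
  have hB0 : 0 ≤ B := (abs_nonneg _).trans (hB _ (hI (-1) (by norm_num))).1
  have lw : Tendsto w atBot (𝓝 0) := by
    apply squeeze_zero_norm' (a := fun t => Real.exp (α * t) * B)
    · filter_upwards [eventually_lt_atBot 0] with t ht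
      simp only [hw, Real.norm_eq_abs]
      rw [abs_mul, abs_of_pos (Real.exp_pos _)]
      exact mul_le_mul_of_nonneg_left (hB _ (hI t ht)).1 (Real.exp_pos _).le
    · simpa using hexpα.mul_const B
  have lz : Tendsto z atBot (𝓝 0) := by
    apply squeeze_zero_norm' (a := fun t => Real.exp (α * t) * (α * B + B))
    · filter_upwards [eventually_lt_atBot 0] with t ht
      simp only [hz, Real.norm_eq_abs]
      rw [abs_mul, abs_of_pos (Real.exp_pos _)]
      refine mul_le_mul_of_nonneg_left ?_ (Real.exp_pos _).le
      refine (abs_add_le _ _).trans (add_le_add ?_ ?_)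
      · rw [abs_mul, abs_of_pos hα0]
        exact mul_le_mul_of_nonneg_left (hB _ (hI t ht)).1 hα0.le
      · rw [abs_mul, abs_of_pos (Real.exp_pos _)]
        have h1 := (hB _ (hI t ht)).2
        have h2 := (hI t ht).2.le
        calc Real.exp t * |deriv u (Real.exp t)| ≤ 1 * B :=
              mul_le_mul h2 h1 (abs_nonneg _) zero_le_one
          _ = B := one_mul B
    · simpa using hexpα.mul_const (α * B + B)
  have hN : ((m - 1 : ℕ) : ℝ) + 1 = m := by
    have : (m - 1) + 1 = m := by omega
    exact_mod_cast this
  have key := ham_bound p β c C K hp hc0 w z hw' hz' lw lz (fun t _ => hb w z t) (m - 1)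
    (((Finset.Icc 1 (m - 1)).image ρ).image Real.log)
    (by
      refine Finset.card_image_le.trans (Finset.card_image_le.trans ?_)
      simp)
    (by
      intro t ht h0
      have h1 : u (Real.exp t) = 0 := by
        rcases mul_eq_zero.mp h0 with h2 | h2
        · exact absurd h2 (Real.exp_pos _).ne'
        · exact h2
      exact Finset.mem_image.mpr ⟨Real.exp t, hzero _ (hI t ht) h1, Real.log_exp t⟩)
    (by rw [hN]; exact hsmall)
  rw [hN] at key
  -- limits at `0⁻`
  have hexp0 : Tendsto Real.exp (𝓝[<] 0) (𝓝[<] 1) := by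
    apply tendsto_nhdsWithin_of_tendsto_nhds_of_eventually_within
    · have := (Real.continuous_exp.tendsto 0).mono_left (nhdsWithin_le_nhds (s := Iio 0))
      simpa using this
    · filter_upwards [self_mem_nhdsWithin] with t ht
      exact Real.exp_lt_one_iff.mpr ht
  have hul : Tendsto u (𝓝[<] 1) (𝓝 (u 1)) := by
    have h1 : Tendsto u (𝓝[Icc 0 1] 1) (𝓝 (u 1)) := hcont 1 ⟨zero_le_one, le_rfl⟩
    refine h1.mono_left ?_
    rw [← nhdsWithin_Ioo_eq_nhdsLT (zero_lt_one' ℝ)]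
    exact nhdsWithin_mono _ Ioo_subset_Icc_self
  have hul' : Tendsto (fun t => u (Real.exp t)) (𝓝[<] 0) (𝓝 (u 1)) := hul.comp hexp0
  have hdl : Tendsto (deriv u) (𝓝[<] 1) (𝓝 0) := by
    have h1 : Tendsto (fun s => s ^ (n - 1) * deriv u s) (𝓝[<] 1) (𝓝 0) := by
      have := hc1.tendsto.mono_left (nhdsWithin_le_nhds (s := Iio 1))
      simpa [hd1] using this
    have h2 : Tendsto (fun s : ℝ => (s ^ (n - 1))⁻¹) (𝓝[<] 1) (𝓝 1) := by
      have : Tendsto (fun s : ℝ => (s ^ (n - 1))⁻¹) (𝓝 1) (𝓝 ((1 ^ (n - 1))⁻¹)) :=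
        ((continuous_pow (n - 1)).tendsto 1).inv₀ (by simp)
      simpa using this.mono_left (nhdsWithin_le_nhds (s := Iio 1))
    have h3 := h2.mul h1
    rw [mul_zero] at h3
    refine h3.congr' ?_
    filter_upwards [Ioo_mem_nhdsLT (zero_lt_one' ℝ)] with s hs
    have : s ^ (n - 1) ≠ 0 := pow_ne_zero _ hs.1.ne'
    field_simp
  have hdl' : Tendsto (fun t => deriv u (Real.exp t)) (𝓝[<] 0) (𝓝 0) := hdl.comp hexp0
  have hE1 : Tendsto (fun t => Real.exp (α * t)) (𝓝[<] 0) (𝓝 1) := by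
    have : Continuous (fun t => Real.exp (α * t)) := by fun_prop
    simpa using (this.tendsto 0).mono_left (nhdsWithin_le_nhds (s := Iio 0))
  have hE2 : Tendsto (fun t => Real.exp t) (𝓝[<] 0) (𝓝 1) := hexp0.mono_right nhdsWithin_le_nhds
  have wl : Tendsto w (𝓝[<] 0) (𝓝 (u 1)) := by simpa using hE1.mul hul'
  have zl : Tendsto z (𝓝[<] 0) (𝓝 (α * u 1)) := by
    simpa using hE1.mul ((hul'.const_mul α).add (hE2.mul hdl'))
  have Hl : Tendsto (Ham p β w z) (𝓝[<] 0)
      (𝓝 ((α * u 1) ^ 2 / 2 - β / 2 * u 1 ^ 2 + |u 1| ^ (p + 1) / (p + 1))) := by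
    have h1 : Tendsto (fun t => |w t| ^ (p + 1)) (𝓝[<] 0) (𝓝 (|u 1| ^ (p + 1))) :=
      wl.abs.rpow_const (Or.inr (by linarith))
    exact (((zl.pow 2).div_const 2).sub ((wl.pow 2).const_mul (β / 2))).add
      (h1.div_const (p + 1))
  have hfin := le_of_tendsto Hl (by
    filter_upwards [self_mem_nhdsWithin] with t ht
    exact key t ht)
  have e : (α * u 1) ^ 2 / 2 - β / 2 * u 1 ^ 2 = α * c / 2 * u 1 ^ 2 := by
    rw [hcα, hβ]; ring
  have h5 : 0 ≤ α * c / 2 * u 1 ^ 2 := by positivity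
  have hpp : 0 < p + 1 := by linarith
  have h6 : |u 1| ^ (p + 1) / (p + 1) ≤ 4 * (c * K * C) * m := by linarith
  rw [div_le_iff₀ hpp] at h6
  linarith

/-- convergence estimate near `1` -/
lemma flat_estimate (n m : ℕ) (hn : 3 ≤ n) (hm : 2 ≤ m) (p : ℝ) (hp : 1 < p) (u : ℝ → ℝ)
    (ρ δ : ℕ → ℝ) (h : NeumannData n p m u ρ δ) :
    ρ 1 ∈ Ioo (0 : ℝ) 1 ∧ u (ρ 1) = 0 ∧ u 1 ≠ 0 ∧ ∀ r ∈ Icc (ρ 1) 1,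
      |u r / u 1 - 1| * r ^ (n - 1) ≤ |u 1| ^ (p - 1) := by
  obtain ⟨hcont, hu1, hu2, hφ, -, hne, hc1, hd1, hρ, hρ0, hcrit, -⟩ :=
    neumann_facts n m hn hm p hp u ρ δ h
  refine ⟨hρ, hρ0, hne, ?_⟩
  have hM : 0 < |u 1| := abs_pos.mpr hne
  have hcont' : ContinuousOn u (Icc (ρ 1) 1) := hcont.mono (Icc_subset_Icc_left hρ.1.le)
  have hle : ∀ r ∈ Icc (ρ 1) 1, |u r| ≤ |u 1| := by
    obtain ⟨x, hx, hmax⟩ := isCompact_Icc.exists_isMaxOn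
      (nonempty_Icc.mpr hρ.2.le) (hcont'.pow 2)
    have hx1 : u x ^ 2 ≤ u 1 ^ 2 := by
      rcases eq_or_lt_of_le hx.1 with h1 | h1
      · rw [← h1, hρ0]; nlinarith [sq_nonneg (u 1)]
      rcases eq_or_lt_of_le hx.2 with h2 | h2
      · rw [h2]
      have hloc : IsLocalMax (fun s => u s ^ 2) x := hmax.isLocalMax (Icc_mem_nhds h1 h2)
      have hdx := (hu1 x ⟨hρ.1.trans h1, h2⟩).pow 2
      have := hloc.hasDerivAt_eq_zero hdx
      have h3 := hcrit x ⟨h1, h2⟩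
      have h4 : u x = 0 := by
        by_contra h5
        simp [h3, h5] at this
      rw [h4]; nlinarith [sq_nonneg (u 1)]
    intro r hr
    exact sq_le_sq.mp ((hmax hr).trans hx1)
  set M := |u 1| with hMdef
  set φ : ℝ → ℝ := fun s => s ^ (n - 1) * deriv u s with hφdef
  have hφ1 : φ 1 = 0 := by simp [hφdef, hd1]
  have hφb : ∀ r ∈ Ioo (ρ 1) 1, |φ r| ≤ M ^ (p - 1) * M := by
    intro r hr
    have hcφ : ContinuousOn φ (Icc r 1) := by
      intro s hs
      rcases eq_or_lt_of_le hs.2 with h2 | h2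
      · rw [h2]; exact hc1.continuousWithinAt
      · exact (hφ s ⟨(hρ.1.trans hr.1).trans_le hs.1, h2⟩).continuousAt.continuousWithinAt
    obtain ⟨s, hs, hs2⟩ := exists_hasDerivAt_eq_slope φ _ hr.2 hcφ
      (fun s hs => hφ s ⟨(hρ.1.trans hr.1).trans hs.1, hs.2⟩)
    rw [hφ1, eq_div_iff (by linarith [hr.2])] at hs2
    have hs0 : 0 < s := (hρ.1.trans hr.1).trans hs.1
    have e : φ r = |u s| ^ (p - 1) * u s * s ^ (n - 1) * (1 - r) := by linarith
    have h1 := hle s ⟨(hr.1.trans hs.1).le, hs.2.le⟩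
    rw [e, abs_mul, abs_mul, abs_mul, abs_of_nonneg (Real.rpow_nonneg (abs_nonneg (u s)) _),
      abs_of_pos (pow_pos hs0 _), abs_of_pos (by linarith [hr.2] : 0 < 1 - r)]
    have h2 : |u s| ^ (p - 1) ≤ M ^ (p - 1) :=
      Real.rpow_le_rpow (abs_nonneg _) h1 (by linarith)
    have h3 : |u s| ^ (p - 1) * |u s| ≤ M ^ (p - 1) * M :=
      mul_le_mul h2 h1 (abs_nonneg _) (Real.rpow_nonneg hM.le _)
    have h4 : s ^ (n - 1) ≤ 1 := pow_le_one₀ hs0.le hs.2.le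
    have h5 : 1 - r ≤ 1 := by linarith [hρ.1, hr.1]
    have h6 : 0 ≤ |u s| ^ (p - 1) * |u s| := by positivity
    calc |u s| ^ (p - 1) * |u s| * s ^ (n - 1) * (1 - r)
        ≤ |u s| ^ (p - 1) * |u s| * 1 * 1 := by
          apply mul_le_mul _ h5 (by linarith [hr.2]) (by simpa using h6)
          exact mul_le_mul_of_nonneg_left h4 h6
      _ ≤ M ^ (p - 1) * M := by simpa using h3
  intro r hr
  have hr0 : 0 < r := hρ.1.trans_le hr.1
  have hrk : 0 < r ^ (n - 1) := pow_pos hr0 _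
  rcases eq_or_lt_of_le hr.2 with h2 | h2
  · rw [h2, div_self hne]
    simpa using Real.rpow_nonneg hM.le (p - 1)
  obtain ⟨s, hs, hs2⟩ := exists_deriv_eq_slope u h2
    (hcont'.mono (Icc_subset_Icc_left hr.1)) (fun s hs =>
      (hu1 s ⟨hr0.trans hs.1, hs.2⟩).differentiableAt.differentiableWithinAt)
  rw [eq_div_iff (by linarith)] at hs2
  have hb := hφb s ⟨hr.1.trans_lt hs.1, hs.2⟩
  have hb2 : r ^ (n - 1) * |deriv u s| ≤ M ^ (p - 1) * M := by
    refine le_trans ?_ hb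
    simp only [hφdef]
    rw [abs_mul, abs_of_pos (pow_pos (hr0.trans hs.1) _)]
    exact mul_le_mul_of_nonneg_right (pow_le_pow_left₀ hr0.le hs.1.le _) (abs_nonneg _)
  have e : |u r / u 1 - 1| = |deriv u s| * (1 - r) / M := by
    have : u r / u 1 - 1 = -(deriv u s * (1 - r)) / u 1 := by
      rw [hs2]; field_simp; ring
    rw [this, abs_div, abs_neg, abs_mul, abs_of_pos (by linarith : 0 < 1 - r)]
  rw [e, div_mul_eq_mul_div, div_le_iff₀ hM]
  refine le_trans ?_ hb2
  have h7 : 0 ≤ r ^ (n - 1) * |deriv u s| := by positivity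
  nlinarith

/-- **Lemma 3.5.** For radial Neumann solutions with `m-1` interior zeros:
`ρ_{1,ε} → 0` and `|u_ε / u_ε(1)| → 1` uniformly on `[a,1]` for every `a ∈ (0,1)`,
as `ε → 0⁺`. -/
theorem neumann_normalized_convergence (n m : ℕ) (hn : 3 ≤ n) (hm : 2 ≤ m)
    (u : ℝ → ℝ → ℝ) (ρ δ : ℝ → ℕ → ℝ)
    (hu : ∀ ε ∈ Set.Ioo (0 : ℝ) (4 / ((n : ℝ) - 2)),
      NeumannData n (pEps n ε) m (u ε) (ρ ε) (δ ε)) :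
    Tendsto (fun ε : ℝ => ρ ε 1) (𝓝[>] (0 : ℝ)) (𝓝 0) ∧
    ∀ a ∈ Set.Ioo (0 : ℝ) 1,
      TendstoUniformlyOn (fun (ε : ℝ) (r : ℝ) => |u ε r / u ε 1|) (fun _ => 1)
        (𝓝[>] (0 : ℝ)) (Set.Icc a 1) := by
  have hn2 : (0 : ℝ) < (n : ℝ) - 2 := by
    have : (3 : ℝ) ≤ n := by exact_mod_cast hn
    linarith
  set q : ℝ := 4 / ((n : ℝ) - 2) with hq
  have hq0 : 0 < q := by positivity
  have hpq : ∀ ε, pEps n ε - 1 = q - ε := by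
    intro ε; unfold pEps; rw [hq]; field_simp; ring
  obtain ⟨C, K, hC0, hK0, hCK⟩ := ham_le_one_bound (q / 2) (q + 2) (((n : ℝ) - 2) ^ 2 / 4)
    (by positivity) (by linarith) (by positivity)
  have hev : ∀ᶠ ε in 𝓝[>] (0 : ℝ), ε ∈ Ioo 0 (q / 2) := Ioo_mem_nhdsGT (by positivity)
  set c : ℝ → ℝ := fun ε => 4 / (q - ε) - ((n : ℝ) - 2) with hcdef
  have hclim : Tendsto c (𝓝[>] 0) (𝓝 0) := by
    have h1 : ContinuousAt c 0 := by
      apply ContinuousAt.sub _ continuousAt_const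
      apply ContinuousAt.div continuousAt_const (by fun_prop)
      simpa using hq0.ne'
    have h2 : c 0 = 0 := by
      simp only [hcdef, hq]; field_simp; ring
    have h3 := h1.tendsto.mono_left (nhdsWithin_le_nhds (s := Ioi 0))
    rwa [h2] at h3
  have hDlim : Tendsto (fun ε => 4 * (c ε * K * C) * m) (𝓝[>] 0) (𝓝 0) := by
    simpa using ((((hclim.mul_const K).mul_const C).const_mul 4).mul_const (m : ℝ))
  have hX : Tendsto (fun ε => |u ε 1| ^ (pEps n ε + 1)) (𝓝[>] 0) (𝓝 0) := by
    apply squeeze_zero' (g := fun ε => (q + 2) * (4 * (c ε * K * C) * m))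
    · exact Eventually.of_forall fun ε => Real.rpow_nonneg (abs_nonneg _) _
    · filter_upwards [hev, hDlim.eventually (gt_mem_nhds one_pos)] with ε hε hsm
      have hp1 := hpq ε
      have hp : 1 < pEps n ε := by linarith [hε.2]
      have hqε : 0 < q - ε := by linarith [hε.2]
      have hc0 : 0 ≤ c ε := by
        have h1 : 4 / q ≤ 4 / (q - ε) :=
          div_le_div_of_nonneg_left (by norm_num) hqε (by linarith [hε.1])
        have h2 : 4 / q = (n : ℝ) - 2 := by rw [hq]; field_simp
        simp only [hcdef]
        linarith
      have hD0 : 0 ≤ 4 * (c ε * K * C) * m := by positivity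
      have h := key_estimate n m hn hm (pEps n ε) hp (u ε) (ρ ε) (δ ε)
        (hu ε ⟨hε.1, by linarith [hε.2]⟩) (c ε)
        (2 / (pEps n ε - 1) * ((n : ℝ) - 2 - 2 / (pEps n ε - 1))) C K
        (by rw [hp1]) hc0 rfl
        (fun w z t => hCK _ _ w z t (by rw [hp1]; linarith [hε.2]) (by linarith [hε.1])
          (by nlinarith [sq_nonneg (2 / (pEps n ε - 1) - ((n : ℝ) - 2) / 2)])) hsm
      exact h.trans (mul_le_mul_of_nonneg_right (by linarith [hε.1]) hD0)
    · simpa using hDlim.const_mul (q + 2)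
  have hplim : Tendsto (fun ε => (q - ε) / (q - ε + 2)) (𝓝[>] 0) (𝓝 (q / (q + 2))) := by
    have h1 : ContinuousAt (fun ε : ℝ => (q - ε) / (q - ε + 2)) 0 := by
      apply ContinuousAt.div (by fun_prop) (by fun_prop)
      simp only [sub_zero]; positivity
    have := h1.tendsto.mono_left (nhdsWithin_le_nhds (s := Ioi 0))
    simpa using this
  have hY : Tendsto (fun ε => |u ε 1| ^ (pEps n ε - 1)) (𝓝[>] 0) (𝓝 0) := by
    have h1 := hX.rpow hplim (Or.inr (by positivity))
    rw [Real.zero_rpow (by positivity)] at h1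
    refine h1.congr' ?_
    filter_upwards [hev] with ε hε
    rw [← Real.rpow_mul (abs_nonneg _), hpq ε]
    congr 1
    have h2 : pEps n ε + 1 = q - ε + 2 := by linarith [hpq ε]
    have h3 : q - ε + 2 ≠ 0 := by linarith [hε.2]
    rw [h2]; field_simp
  have hflat : ∀ᶠ ε in 𝓝[>] (0 : ℝ), ρ ε 1 ∈ Ioo (0 : ℝ) 1 ∧ u ε (ρ ε 1) = 0 ∧ u ε 1 ≠ 0 ∧
      ∀ r ∈ Icc (ρ ε 1) 1,
        |u ε r / u ε 1 - 1| * r ^ (n - 1) ≤ |u ε 1| ^ (pEps n ε - 1) := by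
    filter_upwards [hev] with ε hε
    exact flat_estimate n m hn hm (pEps n ε) (by linarith [hpq ε, hε.2]) (u ε) (ρ ε) (δ ε)
      (hu ε ⟨hε.1, by linarith [hε.2]⟩)
  have hρsmall : ∀ η > 0, ∀ᶠ ε in 𝓝[>] (0 : ℝ), ρ ε 1 < η := by
    intro η hη
    filter_upwards [hflat, hY.eventually (gt_mem_nhds (pow_pos hη (n - 1)))] with ε hf hy
    obtain ⟨hI, h0, -, hr⟩ := hf
    have h1 := hr (ρ ε 1) ⟨le_rfl, hI.2.le⟩
    rw [h0] at h1
    simp only [zero_div, zero_sub, abs_neg, abs_one, one_mul] at h1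
    exact lt_of_pow_lt_pow_left₀ _ hη.le (h1.trans_lt hy)
  constructor
  · rw [Metric.tendsto_nhds]
    intro η hη
    filter_upwards [hflat, hρsmall η hη] with ε hf hr
    rw [Real.dist_eq, sub_zero, abs_of_pos hf.1.1]
    exact hr
  · intro a ha
    rw [Metric.tendstoUniformlyOn_iff]
    intro η hη
    have hak : 0 < a ^ (n - 1) := pow_pos ha.1 _
    filter_upwards [hflat, hρsmall a ha.1,
      hY.eventually (gt_mem_nhds (mul_pos hη hak))] with ε hf hra hy r hr
    have h1 := hf.2.2.2 r ⟨hra.le.trans hr.1, hr.2⟩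
    have h2 : |u ε r / u ε 1 - 1| * a ^ (n - 1) < η * a ^ (n - 1) := by
      refine lt_of_le_of_lt ?_ (h1.trans_lt hy)
      exact mul_le_mul_of_nonneg_left (pow_le_pow_left₀ ha.1.le hr.1 _) (abs_nonneg _)
    have h3 := lt_of_mul_lt_mul_right h2 hak.le
    rw [dist_comm, Real.dist_eq]
    refine lt_of_le_of_lt ?_ h3
    have := abs_abs_sub_abs_le (u ε r / u ε 1) 1
    rwa [abs_one] at this
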